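/- Suppose the ideal I ⊆ R is homogeneous for total degree, every monomial initial ideal of I (i.e. every in_{≼'}(I) for a monomial order ≼') is generated by monomials of total degree at most d, and G acts monomially on I up to degree d. Then for every g ∈ G and all weight vectors w, η ∈ ℝ^n: in_η(I) = in_{g⁻¹(w)}(I) if and only if in_{g(η)}(I) = in_w(I). (Equivalently, the linear action w ↦ g(w) of G on ℝ^n maps the Gröbner cone C[g⁻¹(w)] = {η : in_η(I) = in_{g⁻¹(w)}(I)} bijectively onto the Gröbner cone C[w], so G acts by automorphisms of the Gröbner fan of I.) -/

import Mathlib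

open MvPolynomial

/-- The image of a monomial (exponent vector) under a permutation `g` of the variables. -/
noncomputable def actMon {n : ℕ} (g : Equiv.Perm (Fin n)) (a : Fin n →₀ ℕ) : Fin n →₀ ℕ :=
  Finsupp.mapDomain g a

/-- Total degree of an exponent vector. -/
def tdeg {n : ℕ} (a : Fin n →₀ ℕ) : ℕ := a.sum fun _ e => e

/-- `le` is a monomial order. -/
def IsMonOrder {n : ℕ} (le : (Fin n →₀ ℕ) → (Fin n →₀ ℕ) → Prop) : Prop :=
  (∀ a b, le a b ∨ le b a) ∧ (∀ a b, le a b → le b a → a = b) ∧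
    (∀ a b c, le a b → le b c → le a c) ∧ (∀ a, le 0 a) ∧
    (∀ a b c, le a b → le (a + c) (b + c))

/-- The initial ideal of `I` with respect to the monomial order `le`. -/
noncomputable def initIdeal {k : Type*} [Field k] {n : ℕ}
    (le : (Fin n →₀ ℕ) → (Fin n →₀ ℕ) → Prop) (I : Ideal (MvPolynomial (Fin n) k)) :
    Ideal (MvPolynomial (Fin n) k) :=
  Ideal.span { m | ∃ f ∈ I, f ≠ 0 ∧ ∃ a ∈ f.support,
    (∀ b ∈ f.support, le b a) ∧ m = monomial a (1 : k) }

/-- `G` acts monomially on `I` up to degree `d`. -/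
def MonomialActionUpTo {k : Type*} [Field k] {n : ℕ} {G : Type*} [Group G]
    (ρ : G →* Equiv.Perm (Fin n)) (I : Ideal (MvPolynomial (Fin n) k)) (d : ℕ) : Prop :=
  ∀ g : G, ∀ h ∈ I, h.totalDegree ≤ d →
    ∃ h' ∈ I, h'.support = h.support.image (actMon (ρ g))

/-- The pairing `w · a` of a weight vector with an exponent vector. -/
def wdot {n : ℕ} (w : Fin n → ℝ) (a : Fin n →₀ ℕ) : ℝ := a.sum fun i e => (e : ℝ) * w i

/-- The initial form `in_w(f)`: the sum of the terms of `f` whose exponent vectors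
maximize `w · a`. -/
noncomputable def inW {k : Type*} [Field k] {n : ℕ} (w : Fin n → ℝ)
    (f : MvPolynomial (Fin n) k) : MvPolynomial (Fin n) k :=
  ∑ a ∈ f.support.filter (fun a => ∀ b ∈ f.support, wdot w b ≤ wdot w a),
    monomial a (f.coeff a)

/-- The initial ideal `in_w(I)`: the ideal generated by the initial forms of the nonzero
elements of `I`. -/
noncomputable def inWIdeal {k : Type*} [Field k] {n : ℕ} (w : Fin n → ℝ)
    (I : Ideal (MvPolynomial (Fin n) k)) : Ideal (MvPolynomial (Fin n) k) :=
  Ideal.span { p | ∃ f ∈ I, f ≠ 0 ∧ p = inW w f }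

theorem tdeg_eq_degree {n : ℕ} (a : Fin n →₀ ℕ) : tdeg a = a.degree := rfl

theorem tdeg_add {n : ℕ} (a b : Fin n →₀ ℕ) : tdeg (a + b) = tdeg a + tdeg b := by
  simp [tdeg_eq_degree]

theorem tdeg_mono {n : ℕ} {a b : Fin n →₀ ℕ} (h : a ≤ b) : tdeg a ≤ tdeg b := by
  obtain ⟨c, rfl⟩ := exists_add_of_le h
  simp [tdeg_add]

theorem tdeg_actMon {n : ℕ} (σ : Equiv.Perm (Fin n)) (a : Fin n →₀ ℕ) :
    tdeg (actMon σ a) = tdeg a := by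
  simp [tdeg_eq_degree, actMon, Finsupp.degree_mapDomain]

theorem wdot_eq_weight {n : ℕ} (w : Fin n → ℝ) (a : Fin n →₀ ℕ) :
    wdot w a = Finsupp.weight w a := by
  simp [wdot, Finsupp.weight_apply]

theorem wdot_add {n : ℕ} (w : Fin n → ℝ) (a b : Fin n →₀ ℕ) :
    wdot w (a + b) = wdot w a + wdot w b := by
  simp [wdot_eq_weight]

theorem wdot_actMon {n : ℕ} (w : Fin n → ℝ) (σ : Equiv.Perm (Fin n)) (a : Fin n →₀ ℕ) :
    wdot w (actMon σ a) = wdot (fun i => w (σ i)) a := by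
  unfold wdot actMon
  rw [Finsupp.sum_mapDomain_index (by simp) (by intros; push_cast; ring)]

theorem actMon_injective {n : ℕ} (σ : Equiv.Perm (Fin n)) : Function.Injective (actMon σ) :=
  Finsupp.mapDomain_injective σ.injective

theorem actMon_inv_actMon {n : ℕ} (σ : Equiv.Perm (Fin n)) (a : Fin n →₀ ℕ) :
    actMon σ⁻¹ (actMon σ a) = a := by
  unfold actMon
  rw [← Finsupp.mapDomain_comp]
  convert Finsupp.mapDomain_id
  ext i
  simp

theorem actMon_actMon_inv {n : ℕ} (σ : Equiv.Perm (Fin n)) (a : Fin n →₀ ℕ) :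
    actMon σ (actMon σ⁻¹ a) = a := by
  simpa using actMon_inv_actMon σ⁻¹ a

section InitialForms

variable {k : Type*} [Field k] {n : ℕ}

open Classical in
theorem coeff_inW (w : Fin n → ℝ) (f : MvPolynomial (Fin n) k) (a : Fin n →₀ ℕ) :
    coeff a (inW w f) = if ∀ b ∈ f.support, wdot w b ≤ wdot w a then coeff a f else 0 := by
  simp only [inW, coeff_sum, coeff_monomial, Finset.sum_ite_eq', Finset.mem_filter, mem_support_iff]
  by_cases h : coeff a f = 0 <;> simp [h]

theorem mem_support_inW {w : Fin n → ℝ} {f : MvPolynomial (Fin n) k} {a : Fin n →₀ ℕ} :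
    a ∈ (inW w f).support ↔ a ∈ f.support ∧ ∀ b ∈ f.support, wdot w b ≤ wdot w a := by
  classical
  rw [mem_support_iff, coeff_inW]
  simp [and_comm]

theorem coeff_weightComponent (w : Fin n → ℝ) (c : ℝ) (f : MvPolynomial (Fin n) k)
    (a : Fin n →₀ ℕ) :
    coeff a (weightedHomogeneousComponent w c f) = if wdot w a = c then coeff a f else 0 := by
  rw [coeff_weightedHomogeneousComponent, wdot_eq_weight]

theorem weightComponent_eq_inW {w : Fin n → ℝ} {f : MvPolynomial (Fin n) k} {a : Fin n →₀ ℕ}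
    (ha : a ∈ f.support) (hmax : ∀ b ∈ f.support, wdot w b ≤ wdot w a) :
    weightedHomogeneousComponent w (wdot w a) f = inW w f := by
  classical
  ext m
  rw [coeff_weightComponent, coeff_inW]
  by_cases hm : coeff m f = 0
  · simp [hm]
  · have h : wdot w m = wdot w a ↔ ∀ b ∈ f.support, wdot w b ≤ wdot w m :=
      ⟨fun h b hb => h ▸ hmax b hb,
        fun h => le_antisymm (hmax m (mem_support_iff.2 hm)) (h a ha)⟩
    simp only [h]

theorem weightComponent_eq_inW_or_zero {w : Fin n → ℝ} {f : MvPolynomial (Fin n) k} {c : ℝ}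
    (hc : ∀ b ∈ f.support, wdot w b ≤ c) :
    weightedHomogeneousComponent w c f = inW w f ∨ weightedHomogeneousComponent w c f = 0 := by
  by_cases h : ∃ a ∈ f.support, wdot w a = c
  · obtain ⟨a, ha, rfl⟩ := h
    exact Or.inl (weightComponent_eq_inW ha hc)
  · push Not at h
    right
    ext m
    rw [coeff_weightComponent, coeff_zero]
    split_ifs with hm
    · by_contra h0
      exact h m (mem_support_iff.2 h0) hm
    · rfl

theorem weightComponent_monomial_mul (w : Fin n → ℝ) (c : ℝ) (b : Fin n →₀ ℕ) (r : k)
    (p : MvPolynomial (Fin n) k) :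
    weightedHomogeneousComponent w c (monomial b r * p) =
      monomial b r * weightedHomogeneousComponent w (c - wdot w b) p := by
  ext m
  rw [coeff_weightComponent, coeff_monomial_mul', coeff_monomial_mul']
  by_cases hb : b ≤ m
  · obtain ⟨e, rfl⟩ := exists_add_of_le hb
    have h : wdot w b + wdot w e = c ↔ wdot w e = c - wdot w b := by
      constructor <;> intro h <;> linarith
    simp [coeff_weightComponent, wdot_add, h]
  · simp [hb]

theorem exists_max_wdot (w : Fin n → ℝ) {f : MvPolynomial (Fin n) k} (hf : f ≠ 0) :
    ∃ a ∈ f.support, ∀ b ∈ f.support, wdot w b ≤ wdot w a :=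
  f.support.exists_max_image _ (support_nonempty.2 hf)

theorem inW_mem_inWIdeal {I : Ideal (MvPolynomial (Fin n) k)} (w : Fin n → ℝ)
    {f : MvPolynomial (Fin n) k} (hf : f ∈ I) : inW w f ∈ inWIdeal w I := by
  by_cases h : f = 0
  · simp [h, inW]
  · exact Ideal.subset_span ⟨f, hf, h, rfl⟩

theorem support_monomial_mul_subset {b : Fin n →₀ ℕ} {r : k} {p : MvPolynomial (Fin n) k}
    {m : Fin n →₀ ℕ} (hm : m ∈ (monomial b r * p).support) : ∃ e ∈ p.support, m = b + e := by
  rw [mem_support_iff, coeff_monomial_mul'] at hm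
  split_ifs at hm with h
  · exact ⟨m - b, mem_support_iff.2 (right_ne_zero_of_mul hm), (add_tsub_cancel_of_le h).symm⟩
  · simp at hm

/-- Every weight component of an element of `in_w(I)` is the top weight component of an element
of `I`. -/
theorem exists_weightComponent_eq_of_mem_inWIdeal {I : Ideal (MvPolynomial (Fin n) k)}
    {w : Fin n → ℝ} {p : MvPolynomial (Fin n) k} (hp : p ∈ inWIdeal w I) (c : ℝ) :
    ∃ f ∈ I, (∀ b ∈ f.support, wdot w b ≤ c) ∧
      weightedHomogeneousComponent w c f = weightedHomogeneousComponent w c p := by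
  have add : ∀ p q : MvPolynomial (Fin n) k, ∀ c : ℝ,
      (∃ f ∈ I, (∀ b ∈ f.support, wdot w b ≤ c) ∧
        weightedHomogeneousComponent w c f = weightedHomogeneousComponent w c p) →
      (∃ f ∈ I, (∀ b ∈ f.support, wdot w b ≤ c) ∧
        weightedHomogeneousComponent w c f = weightedHomogeneousComponent w c q) →
      ∃ f ∈ I, (∀ b ∈ f.support, wdot w b ≤ c) ∧
        weightedHomogeneousComponent w c f = weightedHomogeneousComponent w c (p + q) := by
    rintro p q c ⟨f, hf, hfc, hfp⟩ ⟨f', hf', hfc', hfq⟩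
    refine ⟨f + f', I.add_mem hf hf', fun b hb => ?_, by rw [map_add, map_add, hfp, hfq]⟩
    rcases Finset.mem_union.1 (support_add hb) with h | h
    exacts [hfc b h, hfc' b h]
  unfold inWIdeal at hp
  induction hp using Submodule.span_induction generalizing c with
  | mem p hp =>
    obtain ⟨f, hf, h0, rfl⟩ := hp
    obtain ⟨a, ha, hmax⟩ := exists_max_wdot w h0
    rw [← weightComponent_eq_inW ha hmax]
    by_cases hc : wdot w a = c
    · subst hc
      refine ⟨f, hf, hmax, ?_⟩
      ext m
      simp only [coeff_weightComponent]
      split_ifs <;> rfl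
    · refine ⟨0, I.zero_mem, by simp, ?_⟩
      ext m
      simp only [coeff_weightComponent, coeff_zero]
      split_ifs with h1 h2
      · exact absurd (h2.symm.trans h1) hc
      all_goals rfl
  | zero => exact ⟨0, I.zero_mem, by simp, rfl⟩
  | add p q _ _ ihp ihq => exact add p q c (ihp c) (ihq c)
  | smul r p _ ih =>
    rw [smul_eq_mul]
    induction r using MvPolynomial.induction_on' with
    | monomial b r =>
      obtain ⟨f, hf, hfc, hfp⟩ := ih (c - wdot w b)
      refine ⟨monomial b r * f, I.mul_mem_left _ hf, fun m hm => ?_, ?_⟩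
      · obtain ⟨e, he, rfl⟩ := support_monomial_mul_subset hm
        rw [wdot_add]
        linarith [hfc e he]
      · rw [weightComponent_monomial_mul, weightComponent_monomial_mul, hfp]
    | add r s hr hs =>
      rw [add_mul]
      exact add _ _ c hr hs

theorem mem_support_homogeneousComponent {e : ℕ} {f : MvPolynomial (Fin n) k}
    {a : Fin n →₀ ℕ} :
    a ∈ (homogeneousComponent e f).support ↔ tdeg a = e ∧ a ∈ f.support := by
  rw [mem_support_iff, coeff_homogeneousComponent, tdeg_eq_degree]
  simp

end InitialForms

section LeadingMonomials

variable {k : Type*} [Field k] {n : ℕ}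

/-- `a` is the leading monomial of `f` with respect to `le`. -/
def IsLead (le : (Fin n →₀ ℕ) → (Fin n →₀ ℕ) → Prop) (f : MvPolynomial (Fin n) k)
    (a : Fin n →₀ ℕ) : Prop :=
  a ∈ f.support ∧ ∀ b ∈ f.support, le b a

/-- The set of leading monomials of elements of `I`. -/
def leadSet (le : (Fin n →₀ ℕ) → (Fin n →₀ ℕ) → Prop) (I : Ideal (MvPolynomial (Fin n) k)) :
    Set (Fin n →₀ ℕ) :=
  { a | ∃ f ∈ I, IsLead le f a }

/-- The order comparing first total degrees, then weights, then by the tie-breaker `τ`. -/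
def weightOrder (w : Fin n → ℝ) (τ : (Fin n →₀ ℕ) → (Fin n →₀ ℕ) → Prop)
    (a b : Fin n →₀ ℕ) : Prop :=
  tdeg a < tdeg b ∨ tdeg a = tdeg b ∧ (wdot w a < wdot w b ∨ wdot w a = wdot w b ∧ τ a b)

theorem IsMonOrder.weightOrder {τ : (Fin n →₀ ℕ) → (Fin n →₀ ℕ) → Prop} (hτ : IsMonOrder τ)
    (w : Fin n → ℝ) : IsMonOrder (weightOrder w τ) := by
  obtain ⟨total, antisymm, trans, zero, add⟩ := hτ
  refine ⟨fun a b => ?_, fun a b => ?_, fun a b c => ?_, fun a => ?_, fun a b c => ?_⟩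
  · unfold _root_.weightOrder
    rcases lt_trichotomy (tdeg a) (tdeg b) with h | h | h
    · exact Or.inl (Or.inl h)
    · rcases lt_trichotomy (wdot w a) (wdot w b) with h' | h' | h'
      · exact Or.inl (Or.inr ⟨h, Or.inl h'⟩)
      · rcases total a b with t | t
        · exact Or.inl (Or.inr ⟨h, Or.inr ⟨h', t⟩⟩)
        · exact Or.inr (Or.inr ⟨h.symm, Or.inr ⟨h'.symm, t⟩⟩)
      · exact Or.inr (Or.inr ⟨h.symm, Or.inl h'⟩)
    · exact Or.inr (Or.inl h)
  · rintro (h | ⟨h, h' | ⟨h', t⟩⟩) (j | ⟨j, j' | ⟨j', s⟩⟩) <;>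
      first
      | exact antisymm a b t s
      | (exfalso; first | omega | linarith)
  · rintro (h | ⟨h, h' | ⟨h', t⟩⟩) (j | ⟨j, j' | ⟨j', s⟩⟩) <;>
      first
      | exact Or.inr ⟨h.trans j, Or.inr ⟨h'.trans j', trans a b c t s⟩⟩
      | (refine Or.inl ?_; omega)
      | (refine Or.inr ⟨h.trans j, Or.inl ?_⟩; linarith)
  · rcases (Nat.zero_le (tdeg a)).lt_or_eq with h | h
    · exact Or.inl h
    · have : a = 0 := (Finsupp.degree_eq_zero_iff a).1 h.symm
      subst this
      exact Or.inr ⟨rfl, Or.inr ⟨rfl, zero 0⟩⟩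
  · unfold _root_.weightOrder
    rw [tdeg_add, tdeg_add, wdot_add, wdot_add, add_lt_add_iff_right, add_lt_add_iff_right,
      add_left_inj, add_left_inj]
    rintro (h | ⟨h, h' | ⟨h', t⟩⟩)
    exacts [Or.inl h, Or.inr ⟨h, Or.inl h'⟩, Or.inr ⟨h, Or.inr ⟨h', add a b c t⟩⟩]

theorem weightOrder_actMon (w : Fin n → ℝ) (τ : (Fin n →₀ ℕ) → (Fin n →₀ ℕ) → Prop)
    (σ : Equiv.Perm (Fin n)) (a b : Fin n →₀ ℕ) :
    weightOrder w τ (actMon σ a) (actMon σ b) ↔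
      weightOrder (fun i => w (σ i)) (fun a b => τ (actMon σ a) (actMon σ b)) a b := by
  unfold weightOrder
  simp only [tdeg_actMon, wdot_actMon]

theorem IsMonOrder.comp_actMon {le : (Fin n →₀ ℕ) → (Fin n →₀ ℕ) → Prop} (h : IsMonOrder le)
    (σ : Equiv.Perm (Fin n)) : IsMonOrder fun a b => le (actMon σ a) (actMon σ b) := by
  obtain ⟨total, antisymm, trans, zero, add⟩ := h
  refine ⟨fun a b => total _ _, fun a b hab hba => actMon_injective σ (antisymm _ _ hab hba),
    fun a b c => trans _ _ _, fun a => ?_, fun a b c hab => ?_⟩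
  · simpa [actMon] using zero (actMon σ a)
  · simpa [actMon, Finsupp.mapDomain_add] using add _ _ (actMon σ c) hab

theorem exists_isMonOrder : ∃ τ : (Fin n →₀ ℕ) → (Fin n →₀ ℕ) → Prop, IsMonOrder τ := by
  refine ⟨fun a b => toLex a ≤ toLex b, fun a b => le_total _ _,
    fun a b h h' => toLex.injective (le_antisymm h h'), fun a b c => le_trans,
    fun a => Finsupp.toLex_monotone zero_le, fun a b c h => ?_⟩
  exact add_le_add_left h (toLex c)

theorem IsMonOrder.refl {le : (Fin n →₀ ℕ) → (Fin n →₀ ℕ) → Prop} (h : IsMonOrder le)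
    (a : Fin n →₀ ℕ) : le a a := (h.1 a a).elim id id

theorem IsMonOrder.wellFounded {le : (Fin n →₀ ℕ) → (Fin n →₀ ℕ) → Prop} (h : IsMonOrder le) :
    WellFounded fun a b => le a b ∧ a ≠ b := by
  obtain ⟨total, antisymm, trans, zero, add⟩ := h
  have : IsStrictOrder (Fin n →₀ ℕ) fun a b => le a b ∧ a ≠ b :=
    { irrefl := fun a h => h.2 rfl
      trans := fun a b c hab hbc => ⟨trans _ _ _ hab.1 hbc.1, by
        rintro rfl
        exact hab.2 (antisymm _ _ hab.1 hbc.1)⟩ }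
  rw [RelEmbedding.wellFounded_iff_isEmpty]
  refine ⟨fun f => ?_⟩
  obtain ⟨i, j, hij, hle⟩ := wellQuasiOrdered_le (fun i => f i)
  obtain ⟨c, hc⟩ := exists_add_of_le hle
  have hlt : le (f j) (f i) ∧ f j ≠ f i := f.map_rel_iff.2 hij
  have := add 0 c (f i) (zero c)
  rw [zero_add, add_comm, ← hc] at this
  exact hlt.2 (antisymm _ _ hlt.1 this)

theorem IsMonOrder.exists_isLead {le : (Fin n →₀ ℕ) → (Fin n →₀ ℕ) → Prop} (h : IsMonOrder le)
    {f : MvPolynomial (Fin n) k} (hf : f ≠ 0) : ∃ a, IsLead le f a := by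
  have key : ∀ s : Finset (Fin n →₀ ℕ), s.Nonempty → ∃ a ∈ s, ∀ b ∈ s, le b a := by
    intro s hs
    induction hs using Finset.Nonempty.cons_induction with
    | singleton a => exact ⟨a, by simp, by simpa using h.refl a⟩
    | cons a s ha hs ih =>
      obtain ⟨m, hm, hmax⟩ := ih
      rcases h.1 a m with ham | hma
      · exact ⟨m, by simp [hm], by simpa [ham] using hmax⟩
      · refine ⟨a, by simp, fun b hb => ?_⟩
        rcases Finset.mem_cons.1 hb with rfl | hb
        exacts [h.refl _, h.2.2.1 _ _ _ (hmax b hb) hma]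
  exact key _ (support_nonempty.2 hf)

theorem initIdeal_eq_span_leadSet (le : (Fin n →₀ ℕ) → (Fin n →₀ ℕ) → Prop)
    (I : Ideal (MvPolynomial (Fin n) k)) :
    initIdeal le I =
      Ideal.span ((fun a => (monomial a (1 : k) : MvPolynomial (Fin n) k)) '' leadSet le I) := by
  unfold initIdeal
  congr 1
  ext m
  constructor
  · rintro ⟨f, hf, -, a, ha, hmax, rfl⟩
    exact ⟨a, ⟨f, hf, ha, hmax⟩, rfl⟩
  · rintro ⟨a, ⟨f, hf, ha, hmax⟩, rfl⟩
    exact ⟨f, hf, fun h => by simp [h] at ha, a, ha, hmax, rfl⟩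

/-- If the initial ideal is generated in degrees at most `d`, then every leading monomial is
divisible by one of degree at most `d`. -/
theorem exists_le_mem_leadSet_of_initIdeal_eq {le : (Fin n →₀ ℕ) → (Fin n →₀ ℕ) → Prop}
    {I : Ideal (MvPolynomial (Fin n) k)} {d : ℕ} {S : Set (Fin n →₀ ℕ)}
    (hS : ∀ a ∈ S, tdeg a ≤ d)
    (hI : initIdeal le I =
      Ideal.span ((fun a => (monomial a (1 : k) : MvPolynomial (Fin n) k)) '' S))
    {a : Fin n →₀ ℕ} (ha : a ∈ leadSet le I) :
    ∃ t ∈ leadSet le I, t ≤ a ∧ tdeg t ≤ d := by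
  rw [initIdeal_eq_span_leadSet] at hI
  have h1 : (monomial a (1 : k) : MvPolynomial (Fin n) k) ∈
      Ideal.span ((fun a => (monomial a (1 : k) : MvPolynomial (Fin n) k)) '' S) :=
    hI ▸ Ideal.subset_span ⟨a, ha, rfl⟩
  obtain ⟨s, hs, hsa⟩ := mem_ideal_span_monomial_image.1 h1 a (by simp [mem_support_iff])
  have h2 : (monomial s (1 : k) : MvPolynomial (Fin n) k) ∈ Ideal.span
      ((fun a => (monomial a (1 : k) : MvPolynomial (Fin n) k)) '' leadSet le I) :=
    hI ▸ Ideal.subset_span ⟨s, hs, rfl⟩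
  obtain ⟨t, ht, hts⟩ := mem_ideal_span_monomial_image.1 h2 s (by simp [mem_support_iff])
  exact ⟨t, ht, hts.trans hsa, (tdeg_mono hts).trans (hS s hs)⟩

/-- Division with remainder: every monomial is congruent modulo `I` to a combination of
standard monomials that do not exceed it. -/
theorem IsMonOrder.exists_remainder {le : (Fin n →₀ ℕ) → (Fin n →₀ ℕ) → Prop}
    (h : IsMonOrder le) (I : Ideal (MvPolynomial (Fin n) k)) (a : Fin n →₀ ℕ) :
    ∃ r : MvPolynomial (Fin n) k,
      (∀ b ∈ r.support, b ∉ leadSet le I ∧ le b a) ∧ monomial a 1 - r ∈ I := by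
  classical
  induction a using h.wellFounded.induction with
  | _ a ih =>
    by_cases ha : a ∈ leadSet le I
    · obtain ⟨f, hf, haf, hmax⟩ := ha
      choose! r hr hrI using ih
      have hlt : ∀ b ∈ f.support.erase a, le b a ∧ b ≠ a := fun b hb =>
        ⟨hmax b (Finset.mem_of_mem_erase hb), Finset.ne_of_mem_erase hb⟩
      have hfa : coeff a f ≠ 0 := mem_support_iff.1 haf
      refine ⟨-∑ b ∈ f.support.erase a, C ((coeff a f)⁻¹ * coeff b f) * r b, ?_, ?_⟩
      · intro b hb
        rw [support_neg] at hb
        obtain ⟨c, hc, hbc⟩ := Finset.mem_biUnion.1 (support_sum hb)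
        rw [← smul_eq_C_mul] at hbc
        have := hr c (hlt c hc) b (support_smul hbc)
        exact ⟨this.1, h.2.2.1 _ _ _ this.2 (hlt c hc).1⟩
      · have e : monomial a 1 - -∑ b ∈ f.support.erase a, C ((coeff a f)⁻¹ * coeff b f) * r b =
            C (coeff a f)⁻¹ * f -
              ∑ b ∈ f.support.erase a,
                C ((coeff a f)⁻¹ * coeff b f) * (monomial b 1 - r b) := by
          have hsum : C (coeff a f)⁻¹ * f = monomial a 1 +
              ∑ b ∈ f.support.erase a, C ((coeff a f)⁻¹ * coeff b f) * monomial b 1 := by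
            conv_lhs => enter [2]; rw [f.as_sum, ← Finset.add_sum_erase _ _ haf]
            simp only [mul_add, Finset.mul_sum, C_mul_monomial, inv_mul_cancel₀ hfa, mul_one]
          rw [hsum]
          simp only [mul_sub, Finset.sum_sub_distrib]
          ring
        rw [e]
        exact I.sub_mem (I.mul_mem_left _ hf) (I.sum_mem fun b hb =>
          I.mul_mem_left _ (hrI b (hlt b hb)))
    · refine ⟨monomial a 1, fun b hb => ?_, by simp⟩
      rw [Finset.mem_singleton.1 (support_monomial_subset hb)]
      exact ⟨ha, h.refl a⟩

/-- Existence of the elements of a reduced Gröbner basis of a homogeneous ideal. -/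
theorem IsMonOrder.exists_reduced {le : (Fin n →₀ ℕ) → (Fin n →₀ ℕ) → Prop}
    (h : IsMonOrder le) {I : Ideal (MvPolynomial (Fin n) k)}
    (hhom : ∀ f ∈ I, ∀ i : ℕ, homogeneousComponent i f ∈ I)
    {a : Fin n →₀ ℕ} (ha : a ∈ leadSet le I) :
    ∃ f ∈ I, IsLead le f a ∧ (∀ b ∈ f.support, tdeg b = tdeg a) ∧
      ∀ b ∈ f.support, b ∈ leadSet le I → b = a := by
  classical
  obtain ⟨r, hr, hrI⟩ := h.exists_remainder I a
  have hsupp : ∀ b ∈ (monomial a 1 - r).support, b = a ∨ b ∈ r.support := fun b hb => by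
    rcases Finset.mem_union.1 (support_sub _ _ _ hb) with hb | hb
    exacts [Or.inl (Finset.mem_singleton.1 (support_monomial_subset hb)), Or.inr hb]
  have har : coeff a r = 0 := by
    by_contra h0
    exact (hr a (mem_support_iff.2 h0)).1 ha
  refine ⟨_, hhom _ hrI (tdeg a), ⟨?_, fun b hb => ?_⟩, fun b hb => ?_, fun b hb hbI => ?_⟩
  · rw [mem_support_homogeneousComponent, mem_support_iff]
    simp [har]
  · rcases hsupp b (mem_support_homogeneousComponent.1 hb).2 with rfl | hb
    exacts [h.refl _, (hr b hb).2]
  · exact (mem_support_homogeneousComponent.1 hb).1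
  · rcases hsupp b (mem_support_homogeneousComponent.1 hb).2 with rfl | hb
    exacts [rfl, absurd hbI (hr b hb).1]

theorem IsLead.wdot_le {w : Fin n → ℝ} {τ : (Fin n →₀ ℕ) → (Fin n →₀ ℕ) → Prop}
    {f : MvPolynomial (Fin n) k} {a : Fin n →₀ ℕ} (h : IsLead (weightOrder w τ) f a)
    {b : Fin n →₀ ℕ} (hb : b ∈ f.support) (hab : tdeg b = tdeg a) : wdot w b ≤ wdot w a := by
  rcases h.2 b hb with h | ⟨-, h | ⟨h, -⟩⟩
  exacts [absurd hab h.ne, h.le, h.le]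

/-- Leading monomials with respect to an order refining `w` can be read off `in_w(I)`. -/
theorem leadSet_weightOrder {I : Ideal (MvPolynomial (Fin n) k)}
    (hhom : ∀ f ∈ I, ∀ i : ℕ, homogeneousComponent i f ∈ I) (w : Fin n → ℝ)
    (τ : (Fin n →₀ ℕ) → (Fin n →₀ ℕ) → Prop) :
    leadSet (weightOrder w τ) I = leadSet (weightOrder 0 τ) (inWIdeal w I) := by
  have wdot_zero : ∀ a : Fin n →₀ ℕ, wdot 0 a = 0 := fun a => by simp [wdot]
  ext a
  constructor
  · rintro ⟨f, hf, hlead⟩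
    have hmem := @mem_support_homogeneousComponent k _ n (tdeg a) f
    refine ⟨_, inW_mem_inWIdeal w (hhom f hf (tdeg a)), ?_, fun b hb => ?_⟩
    · rw [mem_support_inW]
      exact ⟨hmem.2 ⟨rfl, hlead.1⟩, fun b hb => hlead.wdot_le (hmem.1 hb).2 (hmem.1 hb).1⟩
    · rw [mem_support_inW] at hb
      obtain ⟨hb, hmax⟩ := hb
      have hba := hmem.1 hb
      have hle := hmax a (hmem.2 ⟨rfl, hlead.1⟩)
      rcases hlead.2 b hba.2 with h | ⟨-, h | ⟨-, h⟩⟩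
      · exact Or.inl h
      · exact absurd h hle.not_gt
      · exact Or.inr ⟨hba.1, Or.inr ⟨by simp [wdot_zero], h⟩⟩
  · rintro ⟨p, hp, ha, hmax⟩
    obtain ⟨f, hf, hfc, hfp⟩ := exists_weightComponent_eq_of_mem_inWIdeal hp (wdot w a)
    have hcoeff : ∀ b, wdot w b = wdot w a → coeff b f = coeff b p := fun b hb => by
      have := congrArg (coeff b) hfp
      simpa [coeff_weightComponent, hb] using this
    refine ⟨_, hhom f hf (tdeg a), ?_, fun b hb => ?_⟩
    · rw [mem_support_homogeneousComponent, mem_support_iff, hcoeff a rfl]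
      exact ⟨rfl, mem_support_iff.1 ha⟩
    · obtain ⟨hb1, hb2⟩ := mem_support_homogeneousComponent.1 hb
      refine Or.inr ⟨hb1, (hfc b hb2).lt_or_eq.imp_right fun e => ⟨e, ?_⟩⟩
      rw [mem_support_iff, hcoeff b e, ← mem_support_iff] at hb2
      rcases hmax b hb2 with h | ⟨-, h | ⟨-, h⟩⟩
      · exact absurd hb1 h.ne
      · simp [wdot_zero] at h
      · exact h

/-- Elements of the reduced Gröbner basis have the same initial form for any two weights with the
same initial ideal. -/
theorem inW_eq_inW_of_reduced {I : Ideal (MvPolynomial (Fin n) k)}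
    (hhom : ∀ f ∈ I, ∀ i : ℕ, homogeneousComponent i f ∈ I) {u η : Fin n → ℝ}
    (hI : inWIdeal η I = inWIdeal u I) {τ : (Fin n →₀ ℕ) → (Fin n →₀ ℕ) → Prop}
    (hτ : IsMonOrder τ) {f : MvPolynomial (Fin n) k} (hf : f ∈ I) {a : Fin n →₀ ℕ}
    (hlead : IsLead (weightOrder u τ) f a) (hdeg : ∀ b ∈ f.support, tdeg b = tdeg a)
    (hred : ∀ b ∈ f.support, b ∈ leadSet (weightOrder u τ) I → b = a) :
    inW u f = inW η f := by
  classical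
  have hset : leadSet (weightOrder η τ) I = leadSet (weightOrder u τ) I := by
    rw [leadSet_weightOrder hhom, leadSet_weightOrder hhom, hI]
  have hf0 : f ≠ 0 := by
    rintro rfl
    simpa using hlead.1
  have hlead' : IsLead (weightOrder η τ) f a := by
    obtain ⟨b, hb⟩ := (hτ.weightOrder η).exists_isLead hf0
    have := hred b hb.1 (hset ▸ ⟨f, hf, hb⟩)
    exact this ▸ hb
  by_contra hne
  obtain ⟨b, hb⟩ := (hτ.weightOrder 0).exists_isLead (sub_ne_zero.2 hne)
  have hbI : b ∈ leadSet (weightOrder u τ) I := by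
    rw [leadSet_weightOrder hhom]
    exact ⟨_, Ideal.sub_mem _ (inW_mem_inWIdeal u hf) (hI ▸ inW_mem_inWIdeal η hf), hb⟩
  have hbf : b ∈ f.support := by
    rcases Finset.mem_union.1 (support_sub _ _ _ hb.1) with h | h <;>
      exact (mem_support_inW.1 h).1
  obtain rfl := hred b hbf hbI
  have h0 := hb.1
  rw [mem_support_iff, coeff_sub, coeff_inW, coeff_inW,
    if_pos fun c hc => hlead.wdot_le hc (hdeg c hc),
    if_pos fun c hc => hlead'.wdot_le hc (hdeg c hc), sub_self] at h0
  exact h0 rfl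

/-- The initial forms of a homogeneous Gröbner basis generate `in_w(I)`. -/
theorem inWIdeal_le_of_leadSet {I T : Ideal (MvPolynomial (Fin n) k)}
    (hhom : ∀ f ∈ I, ∀ i : ℕ, homogeneousComponent i f ∈ I) {w : Fin n → ℝ}
    {τ : (Fin n →₀ ℕ) → (Fin n →₀ ℕ) → Prop} (hτ : IsMonOrder τ)
    (hT : ∀ a ∈ leadSet (weightOrder w τ) I, ∃ t ≤ a, ∃ h ∈ I, IsLead (weightOrder w τ) h t ∧
      (∀ b ∈ h.support, tdeg b = tdeg t) ∧ inW w h ∈ T) :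
    inWIdeal w I ≤ T := by
  classical
  have hle := hτ.weightOrder w
  have key : ∀ a : Fin n →₀ ℕ, ∀ f ∈ I, IsLead (weightOrder w τ) f a →
      (∀ b ∈ f.support, tdeg b = tdeg a) → ∀ c : ℝ, (∀ b ∈ f.support, wdot w b ≤ c) →
      weightedHomogeneousComponent w c f ∈ T := by
    intro a
    induction a using hle.wellFounded.induction with
    | _ a ih =>
      intro f hf hlead hdeg c hc
      obtain ⟨t, hta, h, hh, hhlead, hhdeg, hhT⟩ := hT a ⟨f, hf, hlead⟩
      obtain ⟨e, rfl⟩ := exists_add_of_le hta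
      have hht : coeff t h ≠ 0 := mem_support_iff.1 hhlead.1
      set q := monomial e (coeff (t + e) f / coeff t h) * h with hq
      have hqsupp : ∀ b ∈ q.support, tdeg b = tdeg (t + e) ∧ wdot w b ≤ wdot w (t + e) ∧
          weightOrder w τ b (t + e) := by
        intro b hb
        obtain ⟨m, hm, rfl⟩ := support_monomial_mul_subset hb
        have h1 := hhdeg m hm
        have h2 := hhlead.wdot_le hm h1
        have h3 := hle.2.2.2.2 _ _ e (hhlead.2 m hm)
        rw [add_comm e m]
        exact ⟨by rw [tdeg_add, tdeg_add, h1], by rw [wdot_add, wdot_add]; linarith, h3⟩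
      have hqT : weightedHomogeneousComponent w c q ∈ T := by
        rw [hq, weightComponent_monomial_mul]
        refine T.mul_mem_left _ ?_
        have hc' : ∀ b ∈ h.support, wdot w b ≤ c - wdot w e := fun b hb => by
          have h1 := hhlead.wdot_le hb (hhdeg b hb)
          have h2 := hc _ hlead.1
          rw [wdot_add] at h2
          linarith
        rcases weightComponent_eq_inW_or_zero hc' with h | h <;> rw [h]
        exacts [hhT, T.zero_mem]
      have hsub : ∀ b ∈ (f - q).support, tdeg b = tdeg (t + e) ∧ wdot w b ≤ c ∧
          weightOrder w τ b (t + e) := by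
        intro b hb
        rcases Finset.mem_union.1 (support_sub _ _ _ hb) with hb | hb
        · exact ⟨hdeg b hb, hc b hb, hlead.2 b hb⟩
        · obtain ⟨h1, h2, h3⟩ := hqsupp b hb
          exact ⟨h1, h2.trans (hc _ hlead.1), h3⟩
      rw [← sub_add_cancel f q, map_add]
      refine T.add_mem ?_ hqT
      by_cases h0 : f - q = 0
      · simp [h0]
      obtain ⟨b, hb⟩ := hle.exists_isLead h0
      have hbdeg := hsub b hb.1
      refine ih b ⟨hbdeg.2.2, ?_⟩ _ (I.sub_mem hf (I.mul_mem_left _ hh)) hb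
        (fun m hm => (hsub m hm).1.trans hbdeg.1.symm) c fun m hm => (hsub m hm).2.1
      rintro rfl
      refine mem_support_iff.1 hb.1 ?_
      rw [coeff_sub, hq, coeff_monomial_mul', if_pos le_add_self, add_tsub_cancel_right,
        div_mul_cancel₀ _ hht, sub_self]
  refine Ideal.span_le.2 ?_
  rintro _ ⟨f, hf, hf0, rfl⟩
  obtain ⟨a, ha, hmax⟩ := exists_max_wdot w hf0
  rw [← weightComponent_eq_inW ha hmax, SetLike.mem_coe]
  conv => enter [2]; rw [← sum_homogeneousComponent f, map_sum]
  refine T.sum_mem fun i _ => ?_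
  by_cases h0 : homogeneousComponent i f = 0
  · simp [h0]
  obtain ⟨b, hb⟩ := hle.exists_isLead h0
  have hmem := @mem_support_homogeneousComponent k _ n i f
  exact key b _ (hhom f hf i) hb (fun m hm => (hmem.1 hm).1.trans (hmem.1 hb.1).1.symm) _
    fun m hm => hmax m (hmem.1 hm).2

theorem IsLead.image_actMon {le : (Fin n →₀ ℕ) → (Fin n →₀ ℕ) → Prop}
    {σ : Equiv.Perm (Fin n)} {f f' : MvPolynomial (Fin n) k} {a : Fin n →₀ ℕ}
    (hsupp : f'.support = f.support.image (actMon σ))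
    (h : IsLead (fun a b => le (actMon σ a) (actMon σ b)) f a) : IsLead le f' (actMon σ a) := by
  refine ⟨hsupp ▸ Finset.mem_image_of_mem _ h.1, fun b hb => ?_⟩
  rw [hsupp] at hb
  obtain ⟨c, hc, rfl⟩ := Finset.mem_image.1 hb
  exact h.2 c hc

theorem mem_support_inW_actMon {w : Fin n → ℝ} {σ : Equiv.Perm (Fin n)}
    {f f' : MvPolynomial (Fin n) k} (hsupp : f'.support = f.support.image (actMon σ))
    (a : Fin n →₀ ℕ) :
    actMon σ a ∈ (inW w f').support ↔ a ∈ (inW (fun i => w (σ i)) f).support := by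
  rw [mem_support_inW, mem_support_inW, hsupp, (actMon_injective σ).mem_finset_image]
  simp [wdot_actMon]

theorem totalDegree_le_of_tdeg_le {f : MvPolynomial (Fin n) k} {d : ℕ}
    (h : ∀ b ∈ f.support, tdeg b ≤ d) : f.totalDegree ≤ d :=
  Finset.sup_le h

theorem inWIdeal_comp_le {I : Ideal (MvPolynomial (Fin n) k)}
    (hhom : ∀ f ∈ I, ∀ i : ℕ, homogeneousComponent i f ∈ I) {d : ℕ}
    (hgen : ∀ le : (Fin n →₀ ℕ) → (Fin n →₀ ℕ) → Prop, IsMonOrder le →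
      ∃ S : Set (Fin n →₀ ℕ), (∀ a ∈ S, tdeg a ≤ d) ∧
        initIdeal le I =
          Ideal.span ((fun a => (monomial a (1 : k) : MvPolynomial (Fin n) k)) '' S))
    {σ : Equiv.Perm (Fin n)}
    (hσ : ∀ h ∈ I, h.totalDegree ≤ d → ∃ h' ∈ I, h'.support = h.support.image (actMon σ))
    (hσ' : ∀ h ∈ I, h.totalDegree ≤ d → ∃ h' ∈ I, h'.support = h.support.image (actMon σ⁻¹))
    {u η : Fin n → ℝ} (hI : inWIdeal η I = inWIdeal u I) :
    inWIdeal (fun i => u (σ i)) I ≤ inWIdeal (fun i => η (σ i)) I := by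
  classical
  obtain ⟨τ, hτ⟩ := exists_isMonOrder (n := n)
  have hle := hτ.weightOrder u
  have hτσ := hτ.comp_actMon σ
  have hord : (fun a b => weightOrder u τ (actMon σ a) (actMon σ b)) =
      weightOrder (fun i => u (σ i)) (fun a b => τ (actMon σ a) (actMon σ b)) := by
    ext a b
    exact weightOrder_actMon u τ σ a b
  refine inWIdeal_le_of_leadSet hhom hτσ fun a ha => ?_
  obtain ⟨S, hS, hSI⟩ := hgen _ (hτσ.weightOrder fun i => u (σ i))
  obtain ⟨t, ht, hta, htd⟩ := exists_le_mem_leadSet_of_initIdeal_eq hS hSI ha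
  have hσt : actMon σ t ∈ leadSet (weightOrder u τ) I := by
    obtain ⟨p, hp, hplead⟩ := ht
    have hpd : p.totalDegree ≤ d := totalDegree_le_of_tdeg_le fun b hb => by
      rcases hplead.2 b hb with h | ⟨h, -⟩
      exacts [h.le.trans htd, h.le.trans htd]
    obtain ⟨p', hp', hsupp⟩ := hσ p hp hpd
    exact ⟨p', hp', IsLead.image_actMon hsupp (hord ▸ hplead)⟩
  obtain ⟨f, hf, hlead, hdeg, hred⟩ := hle.exists_reduced hhom hσt
  have hform := inW_eq_inW_of_reduced hhom hI hτ hf hlead hdeg hred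
  obtain ⟨h, hh, hsupp'⟩ := hσ' f hf
    (totalDegree_le_of_tdeg_le fun b hb => by rw [hdeg b hb, tdeg_actMon]; exact htd)
  have hsupp : f.support = h.support.image (actMon σ) := by
    rw [hsupp', Finset.image_image]
    ext b
    simp [actMon_actMon_inv]
  have hmem : ∀ b, b ∈ h.support ↔ actMon σ b ∈ f.support := fun b => by
    rw [hsupp, (actMon_injective σ).mem_finset_image]
  refine ⟨t, hta, h, hh, ⟨(hmem t).2 hlead.1, fun b hb => ?_⟩, fun b hb => ?_, ?_⟩
  · exact (weightOrder_actMon u τ σ b t).1 (hlead.2 _ ((hmem b).1 hb))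
  · simpa only [tdeg_actMon] using hdeg _ ((hmem b).1 hb)
  · have : inW (fun i => u (σ i)) h = inW (fun i => η (σ i)) h := by
      ext b
      have hiff : b ∈ (inW (fun i => u (σ i)) h).support ↔
          b ∈ (inW (fun i => η (σ i)) h).support := by
        rw [← mem_support_inW_actMon hsupp, ← mem_support_inW_actMon hsupp, hform]
      by_cases hb : b ∈ h.support
      · rw [mem_support_inW, mem_support_inW, and_iff_right hb, and_iff_right hb] at hiff
        simp only [coeff_inW, hiff]
      · simp [coeff_inW, notMem_support_iff.1 hb]
    rw [this]
    exact inW_mem_inWIdeal _ hh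

theorem inWIdeal_comp_eq {I : Ideal (MvPolynomial (Fin n) k)}
    (hhom : ∀ f ∈ I, ∀ i : ℕ, homogeneousComponent i f ∈ I) {d : ℕ}
    (hgen : ∀ le : (Fin n →₀ ℕ) → (Fin n →₀ ℕ) → Prop, IsMonOrder le →
      ∃ S : Set (Fin n →₀ ℕ), (∀ a ∈ S, tdeg a ≤ d) ∧
        initIdeal le I =
          Ideal.span ((fun a => (monomial a (1 : k) : MvPolynomial (Fin n) k)) '' S))
    (σ : Equiv.Perm (Fin n))
    (hσ : ∀ h ∈ I, h.totalDegree ≤ d → ∃ h' ∈ I, h'.support = h.support.image (actMon σ))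
    (hσ' : ∀ h ∈ I, h.totalDegree ≤ d → ∃ h' ∈ I, h'.support = h.support.image (actMon σ⁻¹))
    {u η : Fin n → ℝ} (hI : inWIdeal η I = inWIdeal u I) :
    inWIdeal (fun i => η (σ i)) I = inWIdeal (fun i => u (σ i)) I :=
  le_antisymm (inWIdeal_comp_le hhom hgen hσ hσ' hI.symm) (inWIdeal_comp_le hhom hgen hσ hσ' hI)

end LeadingMonomials

/-- If `I` is homogeneous for total degree, every monomial initial ideal of `I`
is generated by monomials of total degree at most `d`, and `G` acts monomially on `I` up to
degree `d`, then for every `g ∈ G` and all weight vectors `w, η`: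
`in_η(I) = in_{g⁻¹(w)}(I)` iff `in_{g(η)}(I) = in_w(I)`; that is, `w ↦ g(w)` maps the Gröbner
cone `C[g⁻¹(w)]` bijectively onto `C[w]`, so `G` acts by automorphisms of the Gröbner fan. -/
theorem stmt1 {k : Type*} [Field k] {n : ℕ} {G : Type*} [Group G]
    (ρ : G →* Equiv.Perm (Fin n)) (I : Ideal (MvPolynomial (Fin n) k))
    (hhom : ∀ f ∈ I, ∀ i : ℕ, MvPolynomial.homogeneousComponent i f ∈ I)
    (d : ℕ)
    (hgen : ∀ le : (Fin n →₀ ℕ) → (Fin n →₀ ℕ) → Prop, IsMonOrder le →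
      ∃ S : Set (Fin n →₀ ℕ), (∀ a ∈ S, tdeg a ≤ d) ∧
        initIdeal le I =
          Ideal.span ((fun a => (monomial a (1 : k) : MvPolynomial (Fin n) k)) '' S))
    (hmon : MonomialActionUpTo ρ I d)
    (g : G) (w η : Fin n → ℝ) :
    inWIdeal η I = inWIdeal (fun i => w (ρ g⁻¹ i)) I ↔
      inWIdeal (fun i => η (ρ g i)) I = inWIdeal w I := by
  have h := @inWIdeal_comp_eq k _ n I hhom d hgen
  constructor
  · intro e
    have := h (ρ g) (hmon g) (by simpa using hmon g⁻¹) e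
    simpa using this
  · intro e
    have := h (ρ g⁻¹) (hmon g⁻¹) (by simpa using hmon g) e
    simpa using this
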